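/- Let f, g̃, ḡ be smooth complete vector fields on ℝ^d, and consider the control system ẋ = f(x) + g̃(x)u + ḡ(x)v with controls u, v. Assume that the Lie brackets satisfy {g̃, ḡ} = 0 and {g̃, {g̃, f}} = 0 identically. Then the extended control system ẋ = f(x) + g̃(x)u + ḡ(x)v + {ḡ, {g̃, f}}(x)w (with an additional control w) is a Lie extension of the original system: for every point x₀ ∈ ℝ^d, the closure of the attainable set of the extended system from x₀ (endpoints of trajectories corresponding to piecewise constant controls u, v, w) coincides with the closure of the attainable set of the original system from x₀ (endpoints of trajectories corresponding to piecewise constant controls u, v). -/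

import Mathlib

open Set

/-- Lie bracket of two vector fields on a normed space:
`{X, Y}(x) = DY(x)[X(x)] − DX(x)[Y(x)]`. -/
noncomputable def lieBk {E : Type*} [NormedAddCommGroup E] [NormedSpace ℝ E]
    (X Y : E → E) : E → E :=
  fun x => fderiv ℝ Y x (X x) - fderiv ℝ X x (Y x)

/-- The attainable set of the (polysystem associated to a) control-affine system: the set of
endpoints of concatenations of trajectories, each of which solves `ẋ = X(x)` on a time
interval `[0, T]`, `T ≥ 0`, for some vector field `X` from the admissible family `F`
(for control-affine systems with piecewise constant controls, `F` is the family of fields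
obtained by freezing the controls at constant values). -/
def Reach {E : Type*} [NormedAddCommGroup E] [NormedSpace ℝ E]
    (F : Set (E → E)) (x₀ : E) : Set E :=
  {y | ∃ (k : ℕ) (x : ℕ → E), x 0 = x₀ ∧ x k = y ∧
    ∀ i, i < k → ∃ X ∈ F, ∃ T : ℝ, 0 ≤ T ∧ ∃ γ : ℝ → E,
      γ 0 = x i ∧ γ T = x (i + 1) ∧ ∀ t ∈ Icc (0 : ℝ) T, HasDerivAt γ (X (γ t)) t}

section helpers
open Filter Topology Metric


variable {E : Type*} [NormedAddCommGroup E] [NormedSpace ℝ E]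

theorem lip_ball [ProperSpace E] {F : Type*} [NormedAddCommGroup F] [NormedSpace ℝ F] {g : E → F}
    (hg : ContDiff ℝ 1 g) (R : ℝ) :
    ∃ L : ℝ, 0 ≤ L ∧ ∀ x ∈ closedBall (0 : E) R, ∀ y ∈ closedBall (0 : E) R,
      ‖g x - g y‖ ≤ L * ‖x - y‖ := by
  obtain ⟨K, hK⟩ := LocallyLipschitzOn.exists_lipschitzOnWith_of_compact
    (isCompact_closedBall (0 : E) R) (hg.locallyLipschitz.locallyLipschitzOn)
  refine ⟨K, K.2, fun x hx y hy => ?_⟩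
  have := hK.dist_le_mul x hx y hy
  simpa [dist_eq_norm] using this

theorem quad_ball [ProperSpace E] {g : E → E} (hg : ContDiff ℝ (⊤ : ℕ∞) g) (R : ℝ) :
    ∃ C : ℝ, 0 ≤ C ∧ ∀ x ∈ closedBall (0 : E) R, ∀ y ∈ closedBall (0 : E) R,
      ‖g y - g x - fderiv ℝ g x (y - x)‖ ≤ C * ‖y - x‖ ^ 2 := by
  have h1 : ContDiff ℝ 1 (fderiv ℝ g) :=
    hg.fderiv_right (m := 1) (by norm_cast)
  obtain ⟨C, hC, h⟩ := lip_ball h1 R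
  refine ⟨C, hC, fun x hx y hy => ?_⟩
  have hseg : segment ℝ x y ⊆ closedBall (0 : E) R :=
    (convex_closedBall (0 : E) R).segment_subset hx hy
  have := (convex_segment x y).norm_image_sub_le_of_norm_fderiv_le' (𝕜 := ℝ) (f := g)
    (φ := fderiv ℝ g x) (C := C * ‖y - x‖) (x := x) (y := y)
    (fun z _ => (hg.differentiable (by simp)).differentiableAt)
    (fun z hz => by
      refine (h z (hseg hz) x hx).trans ?_
      gcongr
      obtain ⟨a, b, ha, hb, hab, rfl⟩ := hz
      have : a • x + b • y - x = b • (y - x) := by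
        have : a = 1 - b := by linarith
        subst this; module
      rw [this, norm_smul, Real.norm_of_nonneg hb]
      have : b ≤ 1 := by linarith
      nlinarith [norm_nonneg (y - x)])
    (left_mem_segment ℝ x y) (right_mem_segment ℝ x y)
  calc _ ≤ _ := this
    _ = _ := by ring

/-- Asymptotic Gronwall comparison. -/
theorem asym_gronwall {ι : Type*} {l : Filter ι} {ρ : ι → ℝ} (hρ0 : Tendsto ρ l (𝓝 0))
    (hρ : ∀ᶠ i in l, 0 < ρ i) (z m m' : ι → ℝ → E) (X : ι → E → E) (L : ℝ) (hL : 0 ≤ L)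
    (hz : ∀ᶠ i in l, ∀ σ ∈ Icc (0 : ℝ) 1, HasDerivAt (z i) (X i (z i σ)) σ)
    (hm : ∀ᶠ i in l, ∀ σ ∈ Icc (0 : ℝ) 1, HasDerivAt (m i) (m' i σ) σ)
    (h1 : ∀ η > 0, ∀ᶠ i in l, ‖z i 0 - m i 0‖ ≤ η * ρ i)
    (h2 : ∀ᶠ i in l, ∀ σ ∈ Icc (0 : ℝ) 1, ∀ y, ‖y - m i σ‖ ≤ 1 →
      ‖X i y - X i (m i σ)‖ ≤ L * ‖y - m i σ‖)
    (h3 : ∀ η > 0, ∀ᶠ i in l, ∀ σ ∈ Icc (0 : ℝ) 1, ‖X i (m i σ) - m' i σ‖ ≤ η * ρ i) :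
    ∀ η > 0, ∀ᶠ i in l, ‖z i 1 - m i 1‖ ≤ η * ρ i := by
  intro η hη
  set D := η * Real.exp (-(L + 1)) with hD
  have hDp : 0 < D := by positivity
  have hsmall : ∀ᶠ i in l, ρ i < 1 / η := hρ0.eventually_lt_const (by positivity)
  filter_upwards [hρ, hz, hm, h1 (D / 2) (by positivity), h2, h3 (D / 2) (by positivity), hsmall]
    with i hρ hz hm h1 h2 h3 hs
  have key := image_norm_le_of_norm_deriv_right_lt_deriv_boundary (a := 0) (b := 1)
    (f := fun σ => z i σ - m i σ) (f' := fun σ => X i (z i σ) - m' i σ)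
    (B := fun σ => D * ρ i * Real.exp ((L + 1) * σ))
    (B' := fun σ => D * ρ i * (Real.exp ((L + 1) * σ) * (L + 1)))
    (fun σ hσ => ((hz σ hσ).sub (hm σ hσ)).continuousAt.continuousWithinAt)
    (fun σ hσ => ((hz σ (Ico_subset_Icc_self hσ)).sub
      (hm σ (Ico_subset_Icc_self hσ))).hasDerivWithinAt)
    (by simp; nlinarith [mul_pos hDp hρ])
    (fun σ => by
      have : HasDerivAt (fun σ : ℝ => (L + 1) * σ) (L + 1) σ := by
        simpa using (hasDerivAt_id σ).const_mul (L + 1)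
      exact (this.exp).const_mul _)
    (fun σ hσ he => by
      have hσ' := Ico_subset_Icc_self hσ
      have hle : Real.exp ((L + 1) * σ) ≤ Real.exp (L + 1) := by
        apply Real.exp_le_exp.2; nlinarith [hσ.2]
      have hge : 1 ≤ Real.exp ((L + 1) * σ) := by
        apply Real.one_le_exp; have := hσ.1; positivity
      have hpp := mul_pos hDp hρ
      have hB1 : ‖z i σ - m i σ‖ ≤ 1 := by
        rw [he]
        calc D * ρ i * Real.exp ((L + 1) * σ) ≤ D * ρ i * Real.exp (L + 1) := by gcongr
          _ = η * ρ i := by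
            rw [hD]
            have : Real.exp (-(L + 1)) * Real.exp (L + 1) = 1 := by
              rw [← Real.exp_add]; simp
            linear_combination η * ρ i * this
          _ ≤ 1 := by
            rw [lt_div_iff₀ hη] at hs; linarith
      have e1 := h2 σ hσ' (z i σ) hB1
      have e2 := h3 σ hσ'
      rw [he] at e1
      have : ‖X i (z i σ) - m' i σ‖ ≤
          L * (D * ρ i * Real.exp ((L + 1) * σ)) + D / 2 * ρ i := by
        calc _ = ‖(X i (z i σ) - X i (m i σ)) + (X i (m i σ) - m' i σ)‖ := by congr 1; abel
          _ ≤ _ := (norm_add_le _ _).trans (add_le_add e1 e2)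
      nlinarith)
  have := key (x := 1) (by simp)
  simp only [mul_one] at this
  refine this.trans (le_of_eq ?_)
  rw [hD]
  have : Real.exp (-(L + 1)) * Real.exp (L + 1) = 1 := by
    rw [← Real.exp_add]; simp
  linear_combination η * ρ i * this

/-- Tangent vectors. -/
def Tgt (A : Set E) (a v : E) : Prop :=
  ∀ η > 0, ∃ᶠ h in 𝓝[>] (0 : ℝ), ∃ b ∈ A, ‖b - a - h • v‖ ≤ η * h

theorem Tgt.of_curve {A : Set E} {a v : E} {c : ℝ → E} (h0 : c 0 = a) (hc : HasDerivAt c v 0)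
    (hA : ∀ᶠ t in 𝓝[>] (0 : ℝ), c t ∈ A) : Tgt A a v := by
  intro η hη
  apply Eventually.frequently
  have h := (hasDerivAt_iff_isLittleO.1 hc).def hη
  have h' := h.filter_mono (nhdsWithin_le_nhds (s := Ioi 0))
  filter_upwards [h', hA, self_mem_nhdsWithin] with t ht hA hpos
  refine ⟨c t, hA, ?_⟩
  simpa [h0, abs_of_pos (show (0:ℝ) < t from hpos)] using ht

theorem Tgt.of_limit {A : Set E} {a v : E}
    (h : ∀ η > 0, ∃ w, ‖w - v‖ ≤ η ∧ Tgt A a w) : Tgt A a v := by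
  intro η hη
  obtain ⟨w, hw, ht⟩ := h (η / 2) (by positivity)
  refine ((ht (η / 2) (by positivity)).and_eventually self_mem_nhdsWithin).mono ?_
  rintro t ⟨⟨b, hb, hbt⟩, hpos⟩
  have hpos : 0 < t := hpos
  refine ⟨b, hb, ?_⟩
  calc ‖b - a - t • v‖ = ‖(b - a - t • w) + t • (w - v)‖ := by congr 1; module
    _ ≤ η / 2 * t + t * (η / 2) := by
      refine (norm_add_le _ _).trans (add_le_add hbt ?_)
      rw [norm_smul, Real.norm_of_nonneg hpos.le]; gcongr
    _ = η * t := by ring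

/-- Nagumo. -/
theorem nagumo [ProperSpace E] {A : Set E} (hA : IsClosed A) {X : E → E} (hX : ContDiff ℝ 1 X)
    (hT : ∀ a ∈ A, Tgt A a (X a)) {γ : ℝ → E} {T : ℝ} (hT0 : 0 ≤ T) (h0 : γ 0 ∈ A)
    (hγ : ∀ t ∈ Icc (0 : ℝ) T, HasDerivAt γ (X (γ t)) t) : γ T ∈ A := by
  have hne : A.Nonempty := ⟨_, h0⟩
  have hcont : ContinuousOn γ (Icc 0 T) := fun t ht => (hγ t ht).continuousAt.continuousWithinAt
  obtain ⟨M, hM⟩ := isCompact_Icc.exists_bound_of_continuousOn hcont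
  obtain ⟨L, hL, hlip⟩ := lip_ball hX (3 * M)
  have hM0 : 0 ≤ M := (norm_nonneg _).trans (hM 0 ⟨le_rfl, hT0⟩)
  have key := le_gronwallBound_of_liminf_deriv_right_le (f := fun t => infDist (γ t) A)
    (f' := fun t => L * infDist (γ t) A) (δ := 0) (K := L) (ε := 0) (a := 0) (b := T)
    ((continuous_infDist_pt A).comp_continuousOn hcont)
    (fun t ht r hr => by
      have ht' := Ico_subset_Icc_self ht
      obtain ⟨a, ha, hda⟩ := hA.exists_infDist_eq_dist hne (γ t)
      have hd : infDist (γ t) A ≤ 2 * M := by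
        refine (infDist_le_dist_of_mem h0).trans ?_
        rw [dist_eq_norm]
        refine (norm_sub_le _ _).trans ?_
        linarith [hM t ht', hM 0 ⟨le_rfl, hT0⟩]
      rw [dist_eq_norm] at hda
      have hXa : ‖X (γ t) - X a‖ ≤ L * infDist (γ t) A := by
        rw [hda]
        apply hlip
        · simp; linarith [hM t ht']
        · simp only [mem_closedBall, dist_zero_right]
          have : ‖a‖ ≤ ‖γ t‖ + ‖γ t - a‖ := by
            simpa using norm_sub_le (γ t) (γ t - a)
          linarith [hM t ht']
      set η := (r - L * infDist (γ t) A) / 3 with hη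
      have hηp : 0 < η := by rw [hη]; linarith
      have hd1 := (hasDerivAt_iff_isLittleO.1 (hγ t ht')).def hηp
      have hd2 := hd1.filter_mono (nhdsWithin_le_nhds (s := Ioi t))
      have hfr : ∃ᶠ z in 𝓝[>] t, ∃ b ∈ A, ‖b - a - (z - t) • X a‖ ≤ η * (z - t) := by
        have := hT a ha η hηp
        have hmap : map (fun h => t + h) (𝓝[>] (0 : ℝ)) = 𝓝[>] t := by
          simp
        rw [← hmap, frequently_map]
        simpa using this
      refine ((hfr.and_eventually hd2).and_eventually self_mem_nhdsWithin).mono ?_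
      rintro z ⟨⟨⟨b, hb, hbz⟩, hz⟩, hzt⟩
      have hzt : 0 < z - t := sub_pos.2 hzt
      rw [inv_mul_lt_iff₀ hzt]
      rw [Real.norm_of_nonneg hzt.le] at hz
      have h1 : infDist (γ z) A ≤ ‖γ z - b‖ := by
        rw [← dist_eq_norm]; exact infDist_le_dist_of_mem hb
      have h2 : ‖γ z - b‖ ≤ η * (z - t) + ‖γ t - a‖ + (z - t) * (L * infDist (γ t) A)
          + η * (z - t) := by
        calc ‖γ z - b‖ = ‖(γ z - γ t - (z - t) • X (γ t)) + (γ t - a)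
              + (z - t) • (X (γ t) - X a) + -(b - a - (z - t) • X a)‖ := by congr 1; module
          _ ≤ _ := by
            refine (norm_add_le _ _).trans (add_le_add ((norm_add_le _ _).trans
              (add_le_add ((norm_add_le _ _).trans (add_le_add hz le_rfl)) ?_)) ?_)
            · rw [norm_smul, Real.norm_of_nonneg hzt.le]; gcongr
            · rwa [norm_neg]
      rw [← hda] at h2
      have : r = 3 * η + L * infDist (γ t) A := by rw [hη]; ring
      rw [this]
      nlinarith [mul_pos hηp hzt])
    (by simp [infDist_zero_of_mem h0]) (fun t _ => by simp) T ⟨hT0, le_rfl⟩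
  have h00 : infDist (γ T) A = 0 := by
    apply le_antisymm _ infDist_nonneg
    simpa [gronwallBound_ε0] using key
  exact (hA.mem_iff_infDist_zero hne).2 h00

end helpers

section helpers2
open Filter Topology Metric


variable {E : Type*} [NormedAddCommGroup E] [NormedSpace ℝ E] [ProperSpace E]

theorem deriv_flow {g : E → E} (hg : ContDiff ℝ (⊤ : ℕ∞) g) {z : ℝ → ℝ → E} {t0 : ℝ} {V : ℝ → E}
    (hz : ∀ t, ∀ σ ∈ Icc (0 : ℝ) 1, HasDerivAt (z t) (g (z t σ)) σ)
    (hy : HasDerivAt (fun t => z t 0) (V 0) t0)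
    (hV : ∀ σ ∈ Icc (0 : ℝ) 1, HasDerivAt V (fderiv ℝ g (z t0 σ) (V σ)) σ) :
    HasDerivAt (fun t => z t 1) (V 1) t0 := by
  obtain ⟨M1, hM1⟩ := isCompact_Icc.exists_bound_of_continuousOn
    (fun σ hσ => (hz t0 σ hσ).continuousAt.continuousWithinAt)
  obtain ⟨M2, hM2⟩ := isCompact_Icc.exists_bound_of_continuousOn
    (fun σ hσ => (hV σ hσ).continuousAt.continuousWithinAt)
  have h01 : (0 : ℝ) ∈ Icc (0 : ℝ) 1 := by simp
  have hM10 := (norm_nonneg _).trans (hM1 0 h01)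
  have hM20 := (norm_nonneg _).trans (hM2 0 h01)
  obtain ⟨L, hL, hlip⟩ := lip_ball (hg.of_le (by norm_cast)) (M1 + M2 + 1)
  obtain ⟨C, hC, hq⟩ := quad_ball hg (M1 + M2 + 1)
  have hnear : ∀ e > 0, ∀ᶠ t in 𝓝[≠] t0, |t - t0| < e := by
    intro e he
    apply eventually_nhdsWithin_of_eventually_nhds
    exact Metric.eventually_nhds_iff.2 ⟨e, he, fun t h => by rwa [Real.dist_eq] at h⟩
  have hmb : ∀ t, |t - t0| < 1 → ∀ σ ∈ Icc (0 : ℝ) 1, ‖z t0 σ + (t - t0) • V σ‖ ≤ M1 + M2 := by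
    intro t ht σ hσ
    refine (norm_add_le _ _).trans (add_le_add (hM1 σ hσ) ?_)
    rw [norm_smul, Real.norm_eq_abs]
    nlinarith [hM2 σ hσ, norm_nonneg (V σ), abs_nonneg (t - t0)]
  have key := asym_gronwall (l := 𝓝[≠] t0) (ρ := fun t => |t - t0|)
    (by
      have : Tendsto (fun t => |t - t0|) (𝓝 t0) (𝓝 |t0 - t0|) :=
        Continuous.tendsto (by fun_prop) t0
      simp only [sub_self, abs_zero] at this
      exact this.mono_left nhdsWithin_le_nhds)
    (by
      filter_upwards [self_mem_nhdsWithin] with t ht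
      exact abs_pos.2 (sub_ne_zero.2 ht))
    z (fun t σ => z t0 σ + (t - t0) • V σ)
    (fun t σ => g (z t0 σ) + (t - t0) • (fderiv ℝ g (z t0 σ) (V σ))) (fun _ => g) L hL
    (Eventually.of_forall hz)
    (Eventually.of_forall fun t σ hσ => (hz t0 σ hσ).add ((hV σ hσ).const_smul _))
    (fun η hη => by
      have h := (hasDerivAt_iff_isLittleO.1 hy).def hη
      filter_upwards [h.filter_mono nhdsWithin_le_nhds] with t ht
      simpa [sub_sub] using ht)
    (by
      filter_upwards [hnear 1 one_pos] with t ht σ hσ y hy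
      have hb := hmb t ht σ hσ
      apply hlip
      · simp only [mem_closedBall, dist_zero_right]
        have : ‖y‖ ≤ ‖y - (z t0 σ + (t - t0) • V σ)‖ + ‖z t0 σ + (t - t0) • V σ‖ :=
          norm_le_norm_sub_add _ _
        linarith
      · simp only [mem_closedBall, dist_zero_right]
        linarith)
    (fun η hη => by
      filter_upwards [hnear 1 one_pos, hnear (η / (C * M2 ^ 2 + 1)) (by positivity)]
        with t ht ht2 σ hσ
      have hb := hmb t ht σ hσ
      have := hq (z t0 σ) (by simp; linarith [hM1 σ hσ]) (z t0 σ + (t - t0) • V σ)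
        (by simp only [mem_closedBall, dist_zero_right]; linarith)
      simp only [add_sub_cancel_left, map_smul, norm_smul, Real.norm_eq_abs] at this
      rw [← sub_sub]
      refine this.trans ?_
      rw [lt_div_iff₀ (by positivity)] at ht2
      have h1 : ‖V σ‖ ^ 2 ≤ M2 ^ 2 := by gcongr; exact hM2 σ hσ
      have h0 := abs_nonneg (t - t0)
      calc C * (|t - t0| * ‖V σ‖) ^ 2 = |t - t0| * (|t - t0| * (C * ‖V σ‖ ^ 2)) := by ring
        _ ≤ |t - t0| * (|t - t0| * (C * M2 ^ 2 + 1)) := by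
          have : C * ‖V σ‖ ^ 2 ≤ C * M2 ^ 2 := by gcongr
          gcongr; linarith
        _ ≤ |t - t0| * η := by gcongr
        _ = η * |t - t0| := by ring)
  rw [hasDerivAt_iff_isLittleO, Asymptotics.isLittleO_iff]
  intro c hc
  have := eventually_nhdsWithin_iff.1 (key c hc)
  filter_upwards [this] with t ht
  by_cases htt : t = t0
  · simp [htt]
  · have := ht htt
    simpa [sub_sub] using this

/-- Second-order expansion. -/
def Jet (a : E) (y : ℝ → E) (y1 y2 : E) : Prop :=
  ∀ η > 0, ∀ᶠ r in 𝓝[>] (0 : ℝ), ‖y r - (a + r • y1 + r ^ 2 • y2)‖ ≤ η * r ^ 2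

theorem jet_flow {p q : E → E} (hp : ContDiff ℝ (⊤ : ℕ∞) p) (hq : ContDiff ℝ (⊤ : ℕ∞) q)
    {z : ℝ → ℝ → E} {a y1 y2 : E} (hy : Jet a (fun r => z r 0) y1 y2)
    (hz : ∀ r > 0, ∀ σ ∈ Icc (0 : ℝ) 1,
      HasDerivAt (z r) (r • p (z r σ) + r ^ 2 • q (z r σ)) σ) :
    Jet a (fun r => z r 1) (y1 + p a)
      (y2 + (q a + fderiv ℝ p a y1) + (1 / 2 : ℝ) • fderiv ℝ p a (p a)) := by
  set P := fderiv ℝ p a with hP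
  set M := ‖a‖ + ‖y1‖ + ‖p a‖ + ‖y2‖ + ‖q a‖ + ‖P y1‖ + ‖P (p a)‖ with hM
  have hM0 : 0 ≤ M := by positivity
  obtain ⟨Lp, hLp, hlp⟩ := lip_ball (hp.of_le (by norm_cast)) (3 * M + 1)
  obtain ⟨Lq, hLq, hlq⟩ := lip_ball (hq.of_le (by norm_cast)) (3 * M + 1)
  obtain ⟨C, hC, hqd⟩ := quad_ball hp (3 * M + 1)
  set A : ℝ → E := fun σ => y1 + σ • p a with hA
  set B : ℝ → E := fun σ => y2 + σ • (q a + P y1) + (σ ^ 2 / 2) • P (p a) with hB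
  have hAM : ∀ σ ∈ Icc (0 : ℝ) 1, ‖A σ‖ ≤ M := by
    intro σ hσ
    have h1 : ‖σ • p a‖ ≤ ‖p a‖ := by
      rw [norm_smul, Real.norm_of_nonneg hσ.1]
      exact mul_le_of_le_one_left (norm_nonneg _) hσ.2
    have := norm_add_le y1 (σ • p a)
    have : 0 ≤ ‖a‖ + ‖y2‖ + ‖q a‖ + ‖P y1‖ + ‖P (p a)‖ := by positivity
    simp only [hA]; linarith
  have hBM : ∀ σ ∈ Icc (0 : ℝ) 1, ‖B σ‖ ≤ M := by
    intro σ hσ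
    have h1 : ‖σ • (q a + P y1)‖ ≤ ‖q a‖ + ‖P y1‖ := by
      rw [norm_smul, Real.norm_of_nonneg hσ.1]
      exact (mul_le_of_le_one_left (norm_nonneg _) hσ.2).trans (norm_add_le _ _)
    have h2 : ‖(σ ^ 2 / 2) • P (p a)‖ ≤ ‖P (p a)‖ := by
      rw [norm_smul, Real.norm_of_nonneg (by positivity)]
      exact mul_le_of_le_one_left (norm_nonneg _) (by nlinarith [hσ.1, hσ.2])
    have := norm_add_le (y2 + σ • (q a + P y1)) ((σ ^ 2 / 2) • P (p a))
    have := norm_add_le y2 (σ • (q a + P y1))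
    have : 0 ≤ ‖a‖ + ‖y1‖ + ‖p a‖ := by positivity
    simp only [hB]; linarith
  set m : ℝ → ℝ → E := fun r σ => a + r • A σ + r ^ 2 • B σ with hm
  have hma : ∀ r, 0 < r → r < 1 → ∀ σ ∈ Icc (0 : ℝ) 1, ‖m r σ - a‖ ≤ 2 * M * r := by
    intro r hr hr1 σ hσ
    have : m r σ - a = r • A σ + r ^ 2 • B σ := by simp only [hm]; abel
    rw [this]
    refine (norm_add_le _ _).trans ?_
    rw [norm_smul, norm_smul, Real.norm_of_nonneg hr.le, Real.norm_of_nonneg (by positivity)]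
    have h1 : r * ‖A σ‖ ≤ r * M := by gcongr; exact hAM σ hσ
    have h2 : r ^ 2 * ‖B σ‖ ≤ r * M := by
      gcongr
      · nlinarith
      · exact hBM σ hσ
    linarith
  have haM : ‖a‖ ≤ M := by
    have : 0 ≤ ‖y1‖ + ‖p a‖ + ‖y2‖ + ‖q a‖ + ‖P y1‖ + ‖P (p a)‖ := by positivity
    linarith
  have hmM : ∀ r, 0 < r → r < 1 → ∀ σ ∈ Icc (0 : ℝ) 1, ‖m r σ‖ ≤ 3 * M := by
    intro r hr hr1 σ hσ
    have := hma r hr hr1 σ hσ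
    have h1 : ‖m r σ‖ ≤ ‖m r σ - a‖ + ‖a‖ := norm_le_norm_sub_add _ _
    nlinarith
  have hpos : ∀ᶠ r in 𝓝[>] (0 : ℝ), 0 < r := self_mem_nhdsWithin
  have hlt : ∀ e > 0, ∀ᶠ r in 𝓝[>] (0 : ℝ), r < e := fun e he =>
    eventually_nhdsWithin_of_eventually_nhds (eventually_lt_nhds he)
  set K := 4 * C * M ^ 2 + ‖P‖ * M + 2 * Lq * M with hK
  have hK0 : 0 ≤ K := by positivity
  have key := asym_gronwall (l := 𝓝[>] (0 : ℝ)) (ρ := fun r => r ^ 2)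
    (by
      have : Tendsto (fun r : ℝ => r ^ 2) (𝓝 0) (𝓝 ((0 : ℝ) ^ 2)) :=
        Continuous.tendsto (by fun_prop) 0
      rw [zero_pow two_ne_zero] at this
      exact this.mono_left nhdsWithin_le_nhds)
    (by filter_upwards [hpos] with r hr; positivity)
    z m (fun r σ => r • p a + r ^ 2 • (q a + P y1 + σ • P (p a)))
    (fun r x => r • p x + r ^ 2 • q x) (Lp + Lq) (by positivity)
    (by filter_upwards [hpos] with r hr using hz r hr)
    (Eventually.of_forall fun r σ hσ => by
      have hA' : HasDerivAt A (p a) σ := by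
        have h := ((hasDerivAt_id σ).smul_const (p a)).const_add y1
        rw [one_smul] at h
        exact h
      have hB' : HasDerivAt B (q a + P y1 + σ • P (p a)) σ := by
        have h1 := ((hasDerivAt_id σ).smul_const (q a + P y1)).const_add y2
        have h2 : HasDerivAt (fun σ : ℝ => σ ^ 2 / 2) σ σ := by
          simpa using ((hasDerivAt_id σ).pow 2).div_const 2
        have h3 := h2.smul_const (P (p a))
        rw [one_smul] at h1
        exact h1.add h3
      exact ((hA'.const_smul r).const_add a).add (hB'.const_smul (r ^ 2)))
    (fun η hη => by
      filter_upwards [hy η hη] with r hr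
      simpa [hm, hA, hB] using hr)
    (by
      filter_upwards [hpos, hlt 1 one_pos] with r hr hr1 σ hσ y hy
      have hb := hmM r hr hr1 σ hσ
      have hy1 : y ∈ closedBall (0 : E) (3 * M + 1) := by
        simp only [mem_closedBall, dist_zero_right]
        have : ‖y‖ ≤ ‖y - m r σ‖ + ‖m r σ‖ := norm_le_norm_sub_add _ _
        linarith
      have hm1 : m r σ ∈ closedBall (0 : E) (3 * M + 1) := by
        simp only [mem_closedBall, dist_zero_right]; linarith
      have e1 := hlp y hy1 _ hm1
      have e2 := hlq y hy1 _ hm1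
      calc _ = ‖r • (p y - p (m r σ)) + r ^ 2 • (q y - q (m r σ))‖ := by congr 1; module
        _ ≤ r * ‖p y - p (m r σ)‖ + r ^ 2 * ‖q y - q (m r σ)‖ := by
          refine (norm_add_le _ _).trans (le_of_eq ?_)
          rw [norm_smul, norm_smul, Real.norm_of_nonneg hr.le,
            Real.norm_of_nonneg (by positivity)]
        _ ≤ 1 * ‖p y - p (m r σ)‖ + 1 * ‖q y - q (m r σ)‖ := by
          gcongr; nlinarith
        _ ≤ _ := by rw [add_mul]; linarith)
    (fun η hη => by
      filter_upwards [hpos, hlt 1 one_pos, hlt (η / (K + 1)) (by positivity)]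
        with r hr hr1 hr2 σ hσ
      have hb := hmM r hr hr1 σ hσ
      have hba := hma r hr hr1 σ hσ
      have hm1 : m r σ ∈ closedBall (0 : E) (3 * M + 1) := by
        simp only [mem_closedBall, dist_zero_right]; linarith
      have ha1 : a ∈ closedBall (0 : E) (3 * M + 1) := by
        simp only [mem_closedBall, dist_zero_right]; linarith
      have e1 := hqd a ha1 _ hm1
      have e2 := hlq _ hm1 a ha1
      have hPma : P (m r σ - a) = r • (P y1 + σ • P (p a)) + r ^ 2 • P (B σ) := by
        have : m r σ - a = r • A σ + r ^ 2 • B σ := by simp only [hm]; abel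
        rw [this, map_add, map_smul, map_smul]
        simp [hA]
      have hid : r • p (m r σ) + r ^ 2 • q (m r σ)
            - (r • p a + r ^ 2 • (q a + P y1 + σ • P (p a)))
          = r • (p (m r σ) - p a - P (m r σ - a)) + (r ^ 2 * r) • P (B σ)
            + r ^ 2 • (q (m r σ) - q a) := by
        rw [hPma]; module
      rw [hid]
      have n1 : ‖r • (p (m r σ) - p a - P (m r σ - a))‖ ≤ r * (C * (2 * M * r) ^ 2) := by
        rw [norm_smul, Real.norm_of_nonneg hr.le]
        gcongr
        refine e1.trans ?_
        gcongr
      have n2 : ‖(r ^ 2 * r) • P (B σ)‖ ≤ (r ^ 2 * r) * (‖P‖ * M) := by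
        rw [norm_smul, Real.norm_of_nonneg (by positivity)]
        gcongr
        refine (P.le_opNorm _).trans ?_
        gcongr; exact hBM σ hσ
      have n3 : ‖r ^ 2 • (q (m r σ) - q a)‖ ≤ r ^ 2 * (Lq * (2 * M * r)) := by
        rw [norm_smul, Real.norm_of_nonneg (by positivity)]
        gcongr
        refine e2.trans ?_
        gcongr
      have n4 := (norm_add_le (r • (p (m r σ) - p a - P (m r σ - a)) + (r ^ 2 * r) • P (B σ))
        (r ^ 2 • (q (m r σ) - q a)))
      have n5 := (norm_add_le (r • (p (m r σ) - p a - P (m r σ - a))) ((r ^ 2 * r) • P (B σ)))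
      rw [lt_div_iff₀ (by positivity)] at hr2
      have n6 : r ^ 2 * (r * K) ≤ r ^ 2 * η := by gcongr; linarith [show r * (K + 1) = r * K + r by ring]
      have n7 : r ^ 2 * (r * K) = r * (C * (2 * M * r) ^ 2) + (r ^ 2 * r) * (‖P‖ * M)
        + r ^ 2 * (Lq * (2 * M * r)) := by rw [hK]; ring
      linarith)
  intro η hη
  filter_upwards [key η hη] with r hr
  simpa [hm, hA, hB] using hr

theorem flow_inv {g : E → E} (hg : ContDiff ℝ (⊤ : ℕ∞) g) {φ : E → ℝ → E}
    (h0 : ∀ x, φ x 0 = x) (hφ : ∀ x t, HasDerivAt (φ x) (g (φ x t)) t) (s : ℝ) (x : E) :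
    φ (φ x s) (-s) = x := by
  have d1 : ∀ σ : ℝ, HasDerivAt (fun σ : ℝ => φ x (s - σ * s)) ((-s) • g (φ x (s - σ * s))) σ := by
    intro σ
    have h : HasDerivAt (fun σ : ℝ => s - σ * s) (-s) σ := by
      simpa using ((hasDerivAt_id σ).mul_const s).const_sub s
    exact (hφ x (s - σ * s)).scomp σ h
  have d2 : ∀ σ : ℝ, HasDerivAt (fun σ : ℝ => φ (φ x s) (σ * (-s)))
      ((-s) • g (φ (φ x s) (σ * (-s)))) σ := by
    intro σ
    have h : HasDerivAt (fun σ : ℝ => σ * (-s)) (-s) σ := by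
      simpa using ((hasDerivAt_id σ).mul_const (-s))
    exact (hφ (φ x s) (σ * (-s))).scomp σ h
  obtain ⟨M1, hM1⟩ := isCompact_Icc.exists_bound_of_continuousOn (s := Icc (0 : ℝ) 1)
    (fun σ _ => (d1 σ).continuousAt.continuousWithinAt)
  obtain ⟨M2, hM2⟩ := isCompact_Icc.exists_bound_of_continuousOn (s := Icc (0 : ℝ) 1)
    (fun σ _ => (d2 σ).continuousAt.continuousWithinAt)
  have hsg : ContDiff ℝ 1 (fun y => (-s) • g y) :=
    (hg.of_le (by norm_cast)).const_smul (-s)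
  obtain ⟨L, hL, hlip⟩ := lip_ball hsg (max M1 M2)
  have := ODE_solution_unique_of_mem_Icc_right (a := 0) (b := 1) (v := fun _ y => (-s) • g y)
    (s := fun _ => closedBall (0 : E) (max M1 M2)) (K := ⟨L, hL⟩)
    (f := fun σ : ℝ => φ x (s - σ * s)) (g := fun σ : ℝ => φ (φ x s) (σ * (-s)))
    (fun t _ => LipschitzOnWith.of_dist_le_mul (fun y hy w hw => by
      rw [dist_eq_norm, dist_eq_norm]
      exact hlip y hy w hw))
    (fun σ _ => (d1 σ).continuousAt.continuousWithinAt)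
    (fun σ _ => (d1 σ).hasDerivWithinAt)
    (fun σ hσ => by simpa using Or.inl (hM1 σ (Ico_subset_Icc_self hσ)))
    (fun σ _ => (d2 σ).continuousAt.continuousWithinAt)
    (fun σ _ => (d2 σ).hasDerivWithinAt)
    (fun σ hσ => by simpa using Or.inr (hM2 σ (Ico_subset_Icc_self hσ)))
    (by simp [h0])
  have h1 := this (show (1 : ℝ) ∈ Icc (0 : ℝ) 1 by simp)
  simpa [h0] using h1.symm

theorem tgt_closure {R : Set E} {X : E → E} (hX : ContDiff ℝ 1 X)
    (hR : ∀ (γ : ℝ → E) (T : ℝ), 0 ≤ T → γ 0 ∈ R →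
      (∀ t ∈ Icc (0 : ℝ) T, HasDerivAt γ (X (γ t)) t) → γ T ∈ R) :
    ∀ a ∈ closure R, Tgt (closure R) a (X a) := by
  intro a ha
  obtain ⟨ε, hε, _, r, _, _, hr, hpl⟩ := IsPicardLindelof.of_contDiffAt_one (hX.contDiffAt (x := a))
  obtain ⟨α, hα, L, hαL⟩ :=
    (hpl 0).exists_forall_mem_closedBall_eq_hasDerivWithinAt_lipschitzOnWith
  simp only [zero_sub, zero_add] at hα hαL
  have hr' : (0 : ℝ) < r := hr
  have hd : ∀ x ∈ closedBall a r, ∀ t ∈ Ioo (-ε) ε, HasDerivAt (α x) (X (α x t)) t :=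
    fun x hx t ht => ((hα x hx).2 t (Ioo_subset_Icc_self ht)).hasDerivAt (Icc_mem_nhds ht.1 ht.2)
  have haa : a ∈ closedBall a (r : ℝ) := mem_closedBall_self hr'.le
  have ha0 : α a 0 = a := (hα a haa).1
  have hda := hd a haa 0 (by simp [hε])
  rw [ha0] at hda
  refine Tgt.of_curve ha0 hda ?_
  have h2 : ∀ᶠ t in 𝓝[>] (0 : ℝ), t < ε :=
    eventually_nhdsWithin_of_eventually_nhds (eventually_lt_nhds hε)
  filter_upwards [self_mem_nhdsWithin, h2] with t ht0 htε
  have ht0 : 0 < t := ht0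
  have hc : ContinuousAt (fun x => α x t) a :=
    (hαL t ⟨by linarith, htε.le⟩).continuousOn.continuousAt (closedBall_mem_nhds a hr')
  have hmem : ∃ᶠ x in 𝓝 a, x ∈ R := mem_closure_iff_frequently.1 ha
  have hmem2 : ∃ᶠ x in 𝓝 a, α x t ∈ R := by
    refine (hmem.and_eventually (closedBall_mem_nhds a hr')).mono ?_
    rintro x ⟨hx, hxb⟩
    apply hR (α x) t ht0.le
    · rw [(hα x hxb).1]; exact hx
    · intro τ hτ
      exact hd x hxb τ ⟨by linarith [hτ.1], by linarith [hτ.2]⟩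
  exact mem_closure_iff_frequently.2 (hc.tendsto.frequently hmem2)

end helpers2

section helpers3
open Filter Topology Metric


variable {E : Type*} [NormedAddCommGroup E] [NormedSpace ℝ E]

theorem reach_extend {F : Set (E → E)} {x₀ : E} {X : E → E} (hX : X ∈ F) {γ : ℝ → E} {T : ℝ}
    (hT : 0 ≤ T) (h0 : γ 0 ∈ Reach F x₀)
    (hγ : ∀ t ∈ Icc (0 : ℝ) T, HasDerivAt γ (X (γ t)) t) : γ T ∈ Reach F x₀ := by
  obtain ⟨k, x, hx0, hxk, hx⟩ := h0
  refine ⟨k + 1, fun i => if i ≤ k then x i else γ T, by simp [hx0], by simp, fun i hi => ?_⟩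
  rcases Nat.lt_succ_iff_lt_or_eq.1 hi with h | h
  · obtain ⟨Y, hY, S, hS, δ, h1, h2, h3⟩ := hx i h
    refine ⟨Y, hY, S, hS, δ, ?_, ?_, h3⟩
    · simp [h.le, h1]
    · simp [Nat.succ_le_of_lt h, h2]
  · subst h
    refine ⟨X, hX, T, hT, γ, by simp [hxk], by simp, hγ⟩

theorem self_mem_reach (F : Set (E → E)) (x₀ : E) : x₀ ∈ Reach F x₀ :=
  ⟨0, fun _ => x₀, rfl, rfl, fun i hi => absurd hi (Nat.not_lt_zero i)⟩

theorem lieBk_smooth {X Y : E → E} (hX : ContDiff ℝ (⊤ : ℕ∞) X) (hY : ContDiff ℝ (⊤ : ℕ∞) Y) :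
    ContDiff ℝ (⊤ : ℕ∞) (lieBk X Y) := by
  unfold lieBk
  exact ((hY.fderiv_right (m := (⊤ : ℕ∞)) (by simp)).clm_apply hX).sub
    ((hX.fderiv_right (m := (⊤ : ℕ∞)) (by simp)).clm_apply hY)

theorem fd_smul {g : E → E} (hg : ContDiff ℝ (⊤ : ℕ∞) g) (c : ℝ) (a v : E) :
    fderiv ℝ (fun x => c • g x) a v = c • fderiv ℝ g a v := by
  have h : HasFDerivAt g (fderiv ℝ g a) a :=
    ((hg.differentiable (by simp)) a).hasFDerivAt
  have h2 : HasFDerivAt (fun x => c • g x) (c • fderiv ℝ g a) a := h.const_smul c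
  rw [h2.fderiv]
  rfl

theorem time_scale {φ : ℝ → E} {g : E → E} (h : ∀ t, HasDerivAt φ (g (φ t)) t) (c σ : ℝ) :
    HasDerivAt (fun σ : ℝ => φ (σ * c)) (c • g (φ (σ * c))) σ := by
  have h1 : HasDerivAt (fun σ : ℝ => σ * c) c σ := by
    simpa using (hasDerivAt_id σ).mul_const c
  exact (h (σ * c)).scomp σ h1

variable [ProperSpace E]

theorem conj_flow {f g : E → E} (hf : ContDiff ℝ (⊤ : ℕ∞) f) (hg : ContDiff ℝ (⊤ : ℕ∞) g)
    (hbr : ∀ x, lieBk g (lieBk g f) x = 0) {P : E → ℝ → E} (hP0 : ∀ x, P x 0 = x)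
    (hP : ∀ x t, HasDerivAt (P x) (g (P x t)) t) {y : ℝ → E}
    (hy : ∀ t, HasDerivAt y (f (y t)) t) (s t : ℝ) :
    HasDerivAt (fun t => P (y t) (-s)) (f (P (y t) (-s)) + s • lieBk g f (P (y t) (-s))) t := by
  have hk := lieBk_smooth hg hf
  have key := deriv_flow (g := fun x => (-s) • g x) (hg.const_smul (-s))
    (z := fun t σ => P (y t) (σ * (-s))) (t0 := t)
    (V := fun σ => f (P (y t) (σ * (-s))) + (σ * s) • lieBk g f (P (y t) (σ * (-s))))
    (fun τ σ _ => time_scale (hP (y τ)) (-s) σ)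
    (by simpa [hP0] using hy t)
    (fun σ _ => by
      have h1 := time_scale (hP (y t)) (-s) σ
      set b := P (y t) (σ * (-s)) with hb
      have hfd : HasFDerivAt f (fderiv ℝ f b) b :=
        ((hf.differentiable (by simp)) b).hasFDerivAt
      have hkd : HasFDerivAt (lieBk g f) (fderiv ℝ (lieBk g f) b) b :=
        ((hk.differentiable (by simp)) b).hasFDerivAt
      have h2 := hfd.comp_hasDerivAt σ h1
      have h3 := hkd.comp_hasDerivAt σ h1
      have h4 : HasDerivAt (fun σ : ℝ => σ * s) s σ := by
        simpa using (hasDerivAt_id σ).mul_const s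
      have h5 := h2.add (h4.smul h3)
      refine h5.congr_deriv ?_
      rw [fd_smul hg]
      have e1 := hbr b
      have e2 : fderiv ℝ (lieBk g f) b (g b) = fderiv ℝ g b (lieBk g f b) := by
        rw [← sub_eq_zero]; exact e1
      have e3 : fderiv ℝ f b (g b) = lieBk g f b + fderiv ℝ g b (f b) := by
        simp [lieBk]
      simp only [Function.comp, map_smul, map_add, ← hb, e2, e3]
      module)
  simpa using key

theorem main_aux (f g1 g2 : E → E)
    (hf : ContDiff ℝ (⊤ : ℕ∞) f) (hg1 : ContDiff ℝ (⊤ : ℕ∞) g1) (hg2 : ContDiff ℝ (⊤ : ℕ∞) g2)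
    (cf : ∀ x₀, ∃ γ : ℝ → E, γ 0 = x₀ ∧ ∀ t : ℝ, HasDerivAt γ (f (γ t)) t)
    (cg1 : ∀ x₀, ∃ γ : ℝ → E, γ 0 = x₀ ∧ ∀ t : ℝ, HasDerivAt γ (g1 (γ t)) t)
    (cg2 : ∀ x₀, ∃ γ : ℝ → E, γ 0 = x₀ ∧ ∀ t : ℝ, HasDerivAt γ (g2 (γ t)) t)
    (hbr : ∀ x, lieBk g1 (lieBk g1 f) x = 0) {A : Set E} (hA : IsClosed A)
    (hT : ∀ a ∈ A, ∀ ε u v : ℝ, 0 < ε → Tgt A a (ε • f a + u • g1 a + v • g2 a))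
    (u v w : ℝ) : ∀ a ∈ A,
      Tgt A a (f a + u • g1 a + v • g2 a + w • lieBk g2 (lieBk g1 f) a) := by
  have hT' : ∀ a ∈ A, ∀ ε u v : ℝ, 0 ≤ ε → Tgt A a (ε • f a + u • g1 a + v • g2 a) := by
    intro a ha ε u v hε
    refine Tgt.of_limit fun η hη => ?_
    refine ⟨(ε + η / (‖f a‖ + 1)) • f a + u • g1 a + v • g2 a, ?_, hT a ha _ u v (by positivity)⟩
    have : (ε + η / (‖f a‖ + 1)) • f a + u • g1 a + v • g2 a - (ε • f a + u • g1 a + v • g2 a)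
      = (η / (‖f a‖ + 1)) • f a := by module
    rw [this, norm_smul, Real.norm_of_nonneg (by positivity), div_mul_eq_mul_div,
      div_le_iff₀ (by positivity)]
    nlinarith [norm_nonneg (f a)]
  have hinv : ∀ (ε u v : ℝ), 0 ≤ ε → ∀ (γ : ℝ → E) (T : ℝ), 0 ≤ T → γ 0 ∈ A →
      (∀ t ∈ Icc (0 : ℝ) T, HasDerivAt γ (ε • f (γ t) + u • g1 (γ t) + v • g2 (γ t)) t) →
      γ T ∈ A := by
    intro ε u v hε γ T hT0 h0 hγ
    refine nagumo (X := fun x => ε • f x + u • g1 x + v • g2 x) hA ?_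
      (fun a ha => hT' a ha ε u v hε) hT0 h0 hγ
    exact (((hf.const_smul ε).add (hg1.const_smul u)).add (hg2.const_smul v)).of_le (by norm_cast)
  choose Φ hΦ0 hΦ using cf
  choose P hP0 hP using cg1
  choose Q hQ0 hQ using cg2
  have hΦA : ∀ a ∈ A, ∀ t, 0 ≤ t → Φ a t ∈ A := by
    intro a ha t ht
    refine hinv 1 0 0 zero_le_one (Φ a) t ht (by rwa [hΦ0]) fun τ _ => ?_
    simpa using hΦ a τ
  have hPA : ∀ a ∈ A, ∀ s, P a s ∈ A := by
    intro a ha s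
    have := hinv 0 s 0 le_rfl (fun σ => P a (σ * s)) 1 zero_le_one (by simpa [hP0] using ha)
      fun τ _ => by simpa using time_scale (hP a) s τ
    simpa using this
  have hQA : ∀ a ∈ A, ∀ s, Q a s ∈ A := by
    intro a ha s
    have := hinv 0 0 s le_rfl (fun σ => Q a (σ * s)) 1 zero_le_one (by simpa [hQ0] using ha)
      fun τ _ => by simpa using time_scale (hQ a) s τ
    simpa using this
  obtain ⟨k, hkdef⟩ : ∃ k, k = lieBk g1 f := ⟨_, rfl⟩
  have hk : ContDiff ℝ (⊤ : ℕ∞) k := hkdef ▸ lieBk_smooth hg1 hf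
  -- conjugated flows
  obtain ⟨G, hG0, hG, hGA⟩ : ∃ G : ℝ → E → ℝ → E, (∀ s x, G s x 0 = x) ∧
      (∀ s x t, HasDerivAt (G s x) (f (G s x t) + s • k (G s x t)) t) ∧
      (∀ s, ∀ a ∈ A, ∀ t, 0 ≤ t → G s a t ∈ A) := by
    refine ⟨fun s x t => P (Φ (P x s) t) (-s), fun s x => ?_, fun s x t => ?_,
      fun s a ha t ht => hPA _ (hΦA _ (hPA _ ha _) t ht) _⟩
    · simp only [hΦ0]; exact flow_inv hg1 hP0 hP s x
    · rw [hkdef]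
      exact conj_flow hf hg1 hbr hP0 hP (hΦ (P x s)) s t
  rw [← hkdef]
  intro a ha
  have hc0 : ContDiff ℝ (⊤ : ℕ∞) (fun _ : E => (0 : E)) := contDiff_const
  have j0 : Jet a (fun r => Q a (0 * r)) 0 0 := by
    intro η hη
    filter_upwards with r
    simp only [zero_mul, hQ0, smul_zero, add_zero, sub_self, norm_zero]
    positivity
  have hGs : ∀ (w r : ℝ), 0 < r → ∀ x σ, HasDerivAt (fun σ : ℝ => G (w / r) x (σ * r ^ 2))
      (r • (w • k (G (w / r) x (σ * r ^ 2))) + r ^ 2 • f (G (w / r) x (σ * r ^ 2))) σ := by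
    intro w r hr x σ
    have := time_scale (g := fun y => f y + (w / r) • k y) (hG (w / r) x) (r ^ 2) σ
    refine this.congr_deriv ?_
    rw [smul_add, smul_smul, smul_smul, add_comm]
    congr 2
    field_simp
  have j1 := jet_flow (p := g2) (q := fun _ => 0) hg2 hc0 (z := fun r σ => Q a (σ * r)) j0
    (fun r hr σ _ => by simpa using time_scale (hQ a) r σ)
  have j2 := jet_flow (p := fun x => w • k x) (q := f) (hk.const_smul w) hf
    (z := fun r σ => G (w / r) (Q a (1 * r)) (σ * r ^ 2)) (by simpa only [zero_mul, hG0] using j1)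
    (fun r hr σ _ => hGs w r hr _ σ)
  have j3 := jet_flow (p := fun x => (-2 : ℝ) • g2 x) (q := fun _ => 0) (hg2.const_smul (-2)) hc0
    (z := fun r σ => Q (G (w / r) (Q a (1 * r)) (1 * r ^ 2)) (σ * (r * (-2))))
    (by simpa only [zero_mul, hQ0] using j2)
    (fun r hr σ _ => by
      refine (time_scale (hQ _) (r * (-2)) σ).congr_deriv ?_
      rw [smul_zero, add_zero, smul_smul])
  have j4 := jet_flow (p := fun x => (-w) • k x) (q := f) (hk.const_smul (-w)) hf
    (z := fun r σ => G (-w / r) (Q (G (w / r) (Q a (1 * r)) (1 * r ^ 2)) (1 * (r * (-2))))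
      (σ * r ^ 2)) (by simpa only [zero_mul, hG0] using j3)
    (fun r hr σ _ => hGs (-w) r hr _ σ)
  have j5 := jet_flow (p := g2) (q := fun _ => 0) hg2 hc0
    (z := fun r σ => Q (G (-w / r) (Q (G (w / r) (Q a (1 * r)) (1 * r ^ 2)) (1 * (r * (-2))))
      (1 * r ^ 2)) (σ * r)) (by simpa only [zero_mul, hQ0] using j4)
    (fun r hr σ _ => by
      refine (time_scale (hQ _) r σ).congr_deriv ?_
      rw [smul_zero, add_zero])
  have j6 := jet_flow (p := fun _ => 0) (q := fun x => (2 * u) • g1 x) hc0 (hg1.const_smul (2 * u))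
    (z := fun r σ => P (Q (G (-w / r) (Q (G (w / r) (Q a (1 * r)) (1 * r ^ 2)) (1 * (r * (-2))))
      (1 * r ^ 2)) (1 * r)) (σ * (r ^ 2 * (2 * u)))) (by simpa only [zero_mul, hP0] using j5)
    (fun r hr σ _ => by
      refine (time_scale (hP _) (r ^ 2 * (2 * u)) σ).congr_deriv ?_
      rw [smul_zero, zero_add, smul_smul])
  have j7 := jet_flow (p := fun _ => 0) (q := fun x => (2 * v) • g2 x) hc0 (hg2.const_smul (2 * v))
    (z := fun r σ => Q (P (Q (G (-w / r) (Q (G (w / r) (Q a (1 * r)) (1 * r ^ 2))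
      (1 * (r * (-2)))) (1 * r ^ 2)) (1 * r)) (1 * (r ^ 2 * (2 * u)))) (σ * (r ^ 2 * (2 * v))))
    (by simpa only [zero_mul, hQ0] using j6)
    (fun r hr σ _ => by
      refine (time_scale (hQ _) (r ^ 2 * (2 * v)) σ).congr_deriv ?_
      rw [smul_zero, zero_add, smul_smul])
  clear j0 j1 j2 j3 j4 j5 j6
  intro η hη
  have ht : Tendsto (fun r : ℝ => 2 * r ^ 2) (𝓝[>] 0) (𝓝[>] 0) := by
    rw [tendsto_nhdsWithin_iff]
    constructor
    · have : Tendsto (fun r : ℝ => 2 * r ^ 2) (𝓝 0) (𝓝 (2 * (0 : ℝ) ^ 2)) :=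
        Continuous.tendsto (by fun_prop) 0
      simp only [ne_eq, OfNat.ofNat_ne_zero, not_false_eq_true, zero_pow, mul_zero] at this
      exact this.mono_left nhdsWithin_le_nhds
    · filter_upwards [self_mem_nhdsWithin] with r hr
      have : 0 < r := hr
      exact mem_Ioi.2 (by positivity)
  refine ht.frequently (Eventually.frequently ?_)
  filter_upwards [j7 η hη, self_mem_nhdsWithin] with r hr hpos
  have hpos : 0 < r := hpos
  refine ⟨Q (P (Q (G (-w / r) (Q (G (w / r) (Q a (1 * r)) (1 * r ^ 2)) (1 * (r * (-2))))
    (1 * r ^ 2)) (1 * r)) (1 * (r ^ 2 * (2 * u)))) (1 * (r ^ 2 * (2 * v))), ?_, ?_⟩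
  · have h2 : 0 ≤ 1 * r ^ 2 := by positivity
    exact hQA _ (hPA _ (hQA _ (hGA _ _ (hQA _ (hGA _ _ (hQA _ ha _) _ h2) _) _ h2) _) _) _
  · refine le_trans (le_of_eq ?_) (hr.trans ?_)
    · congr 1
      rw [sub_sub]
      congr 1
      simp only [fd_smul hg2, fd_smul hk, map_add, map_smul, map_zero, lieBk,
        fderiv_fun_const, Pi.zero_apply, ContinuousLinearMap.zero_apply]
      module
    · nlinarith [mul_pos hη (pow_pos hpos 2)]

end helpers3

/-- **Proposition (key Lie extension).** Let `f, g̃, ḡ` be smooth complete vector fields on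
`ℝ^d` with `{g̃, ḡ} = 0` and `{g̃, {g̃, f}} = 0`. Then adding the controlled vector field
`{ḡ, {g̃, f}}` to the control system `ẋ = f + g̃ u + ḡ v` is a Lie extension: for every `x₀`
the closures of the attainable sets (for piecewise constant controls) of the original and
the extended systems coincide. -/
theorem lie_extension_double_bracket
    (d : ℕ) (f g1 g2 : EuclideanSpace ℝ (Fin d) → EuclideanSpace ℝ (Fin d))
    (hf : ContDiff ℝ (⊤ : ℕ∞) f) (hg1 : ContDiff ℝ (⊤ : ℕ∞) g1)
    (hg2 : ContDiff ℝ (⊤ : ℕ∞) g2)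
    (hcomplete : ∀ X : EuclideanSpace ℝ (Fin d) → EuclideanSpace ℝ (Fin d),
      (X = f ∨ X = g1 ∨ X = g2) → ∀ x₀, ∃ γ : ℝ → EuclideanSpace ℝ (Fin d),
        γ 0 = x₀ ∧ ∀ t : ℝ, HasDerivAt γ (X (γ t)) t)
    (hbr1 : ∀ x, lieBk g1 g2 x = 0)
    (hbr2 : ∀ x, lieBk g1 (lieBk g1 f) x = 0) :
    ∀ x₀ : EuclideanSpace ℝ (Fin d),
      closure (Reach {X | ∃ u v : ℝ, X = fun x => f x + u • g1 x + v • g2 x} x₀) =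
      closure (Reach {X | ∃ u v w : ℝ,
        X = fun x => f x + u • g1 x + v • g2 x + w • lieBk g2 (lieBk g1 f) x} x₀) := by
  intro x₀
  apply Subset.antisymm
  · apply closure_mono
    rintro y ⟨k, x, h0, hk, h⟩
    refine ⟨k, x, h0, hk, fun i hi => ?_⟩
    obtain ⟨X, ⟨u, v, rfl⟩, h⟩ := h i hi
    exact ⟨fun x => f x + u • g1 x + v • g2 x, ⟨u, v, 0, by funext x; simp⟩, h⟩
  · apply closure_minimal _ isClosed_closure
    set R := Reach {X | ∃ u v : ℝ, X = fun x => f x + u • g1 x + v • g2 x} x₀ with hR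
    have hT : ∀ a ∈ closure R, ∀ ε u v : ℝ, 0 < ε →
        Tgt (closure R) a (ε • f a + u • g1 a + v • g2 a) := by
      intro a ha ε u v hε
      refine tgt_closure (X := fun x => ε • f x + u • g1 x + v • g2 x) ?_ ?_ a ha
      · exact (((hf.const_smul ε).add (hg1.const_smul u)).add
          (hg2.const_smul v)).of_le (by norm_cast)
      · intro γ T hT0 h0 hγ
        have := reach_extend (F := {X | ∃ u v : ℝ, X = fun x => f x + u • g1 x + v • g2 x})
          (x₀ := x₀) (X := fun x => f x + (ε⁻¹ * u) • g1 x + (ε⁻¹ * v) • g2 x)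
          ⟨_, _, rfl⟩ (γ := fun τ => γ (τ * ε⁻¹)) (T := T * ε) (by positivity)
          (by simpa using h0)
          (fun τ hτ => by
            have h1 : HasDerivAt (fun σ : ℝ => σ * ε⁻¹) ε⁻¹ τ := by
              simpa using (hasDerivAt_id τ).mul_const ε⁻¹
            have h2 := (hγ (τ * ε⁻¹) ⟨by have := hτ.1; positivity, by
              rw [← div_eq_mul_inv, div_le_iff₀ hε]; exact hτ.2⟩).scomp τ h1
            refine h2.congr_deriv ?_
            simp only [smul_add, smul_smul, inv_mul_cancel₀ hε.ne', one_smul])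
        simpa [mul_assoc, mul_inv_cancel₀ hε.ne'] using this
    have hmain := main_aux f g1 g2 hf hg1 hg2 (hcomplete f (by simp)) (hcomplete g1 (by simp))
      (hcomplete g2 (by simp)) hbr2 isClosed_closure hT
    rintro y ⟨k, x, h0, rfl, h⟩
    have : ∀ i, i ≤ k → x i ∈ closure R := by
      intro i
      induction i with
      | zero => intro _; rw [h0]; exact subset_closure (self_mem_reach _ _)
      | succ i ih =>
        intro hi
        obtain ⟨X, ⟨u, v, w, rfl⟩, T, hT0, γ, e0, e1, hγ⟩ := h i (Nat.lt_of_succ_le hi)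
        rw [← e1]
        refine nagumo isClosed_closure ?_ (hmain u v w) hT0
          (e0 ▸ ih (Nat.le_of_succ_le hi)) hγ
        exact ((((hf.add (hg1.const_smul u)).add (hg2.const_smul v)).add
          ((lieBk_smooth hg2 (lieBk_smooth hg1 hf)).const_smul w))).of_le (by norm_cast)
    exact this k le_rfl
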